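/- For every d ≥ 1, Z_d(2n) equals the sum, over all d-tuples (χ₁,…,χ_d) of irreducible complex characters of G = S_{2n} satisfying Σ_{h ∈ H} χᵢ(h) ≠ 0 for each i, of C_d(χ₁,…,χ_d) = (1/(2n)!) · Σ_{γ ∈ G} χ₁(γ)·χ₂(γ)⋯χ_d(γ). -/

import Mathlib

/-- The symmetric group `S_{2n}`. -/
abbrev PermG (n : ℕ) := Equiv.Perm (Fin (2 * n))

/-- The centralizer `H` of the fixed-point-free involution `ξ` in `S_{2n}`;
it is isomorphic to the wreath product `S_n[S₂]` and has order `2ⁿ·n!`. -/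
def wreathH (n : ℕ) (ξ : PermG n) : Subgroup (PermG n) :=
  Subgroup.centralizer {ξ}

/-- Two `d`-tuples `(σ₁,…,σ_d), (σ'₁,…,σ'_d) ∈ G^d` are equivalent if there exist
`γ₁,…,γ_d ∈ H` and `γ ∈ G` with `σ'ᵢ = γᵢσᵢγ` for all `i`. -/
def tensorRel (n d : ℕ) (ξ : PermG n) (σ σ' : Fin d → PermG n) : Prop :=
  ∃ (γv : Fin d → wreathH n ξ) (γ : PermG n),
    ∀ i, σ' i = (γv i : PermG n) * σ i * γ

/-- `Z_d(2n)`: the number of equivalence classes of `d`-tuples, i.e. the number of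
rank-`d` `O(N)` tensor invariants built from `2n` tensors. -/
noncomputable def Znum (n d : ℕ) (ξ : PermG n) : ℕ :=
  Nat.card (Quot (tensorRel n d ξ))

/-- The set of irreducible complex characters of `G = S_{2n}`: characters of irreducible
finite-dimensional complex representations. -/
def irredChars (n : ℕ) : Set (PermG n → ℂ) :=
  {χ | ∃ V : FDRep ℂ (PermG n), CategoryTheory.Simple V ∧ χ = V.character}

/-- The irreducible complex characters `χ` of `G = S_{2n}` with `Σ_{h ∈ H} χ(h) ≠ 0`
(those labelled by partitions of `2n` all of whose row lengths are even). -/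
def goodChars (n : ℕ) (ξ : PermG n) : Set (PermG n → ℂ) :=
  {χ ∈ irredChars n | (∑ᶠ h : wreathH n ξ, χ (h : PermG n)) ≠ 0}

theorem Equiv.Perm.mul_zpow_mul_apply_ne {α : Type*} {ξ η : Equiv.Perm α} (hξ : ξ * ξ = 1)
    (hη : η * η = 1) (fξ : ∀ x, ξ x ≠ x) (fη : ∀ x, η x ≠ x) (i : ℤ) (x : α) :
    ξ (((ξ * η) ^ i) x) ≠ x := by
  have hξ' : ξ⁻¹ = ξ := inv_eq_of_mul_eq_one_left hξ
  have hη' : η⁻¹ = η := inv_eq_of_mul_eq_one_left hη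
  have hc : ∀ j : ℤ, ξ * (ξ * η) ^ j = (ξ * η) ^ (-j) * ξ := fun j => by
    have h1 : ξ * (ξ * η) ^ j * ξ⁻¹ = (ξ * η) ^ (-j) := by
      rw [← conj_zpow, zpow_neg, ← inv_zpow, mul_inv_rev, hξ', hη', ← mul_assoc, hξ, one_mul]
    rw [← h1, inv_mul_cancel_right]
  intro h
  obtain ⟨j, rfl | rfl⟩ := Int.even_or_odd' i
  · apply fξ (((ξ * η) ^ j) x)
    have h2 : ξ * (ξ * η) ^ (2 * j) = (ξ * η) ^ (-j) * ξ * (ξ * η) ^ j := by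
      rw [← hc, mul_assoc, ← zpow_add, two_mul]
    rw [← Equiv.Perm.mul_apply, h2, zpow_neg, Equiv.Perm.mul_apply, Equiv.Perm.mul_apply,
      Equiv.Perm.inv_eq_iff_eq] at h
    exact h
  · apply fη (((ξ * η) ^ j) x)
    have h2 : ξ * (ξ * η) ^ (2 * j + 1) = (ξ * η) ^ (-j) * η * (ξ * η) ^ j := by
      rw [show 2 * j + 1 = j + 1 + j by ring, zpow_add, zpow_add, ← mul_assoc, ← mul_assoc, hc,
        zpow_one, mul_assoc _ ξ (ξ * η), ← mul_assoc ξ ξ η, hξ, one_mul]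
    rw [← Equiv.Perm.mul_apply, h2, zpow_neg, Equiv.Perm.mul_apply, Equiv.Perm.mul_apply,
      Equiv.Perm.inv_eq_iff_eq] at h
    exact h

/-- Two fixed-point-free involutions can be interchanged by a simultaneous conjugation. -/
theorem Equiv.Perm.exists_conj_swap {α : Type*} {ξ η : Equiv.Perm α} (hξ : ξ * ξ = 1)
    (hη : η * η = 1) (fξ : ∀ x, ξ x ≠ x) (fη : ∀ x, η x ≠ x) :
    ∃ k : Equiv.Perm α, k * ξ = η * k ∧ k * η = ξ * k := by
  have hξ' : ξ⁻¹ = ξ := inv_eq_of_mul_eq_one_left hξ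
  have hη' : η⁻¹ = η := inv_eq_of_mul_eq_one_left hη
  have hξx : ∀ x, ξ (ξ x) = x := fun x => by rw [← Equiv.Perm.mul_apply, hξ]; rfl
  have hηx : ∀ x, η (η x) = x := fun x => by rw [← Equiv.Perm.mul_apply, hη]; rfl
  set ρ := ξ * η with hρ
  have hc : ∀ (j : ℤ) x, ξ ((ρ ^ j) x) = (ρ ^ (-j)) (ξ x) := fun j x => by
    have h1 : ξ * ρ ^ j * ξ⁻¹ = ρ ^ (-j) := by
      rw [← conj_zpow, zpow_neg, ← inv_zpow, hρ, mul_inv_rev, hξ', hη', ← mul_assoc, hξ, one_mul]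
    rw [← h1]; simp
  have hadd : ∀ (i j : ℤ) x, (ρ ^ i) ((ρ ^ j) x) = (ρ ^ (i + j)) x := fun i j x => by
    rw [zpow_add]; rfl
  have hηρ : ∀ (j : ℤ) x, η ((ρ ^ j) x) = ξ ((ρ ^ (j + 1)) x) := fun j x => by
    rw [add_comm, ← hadd, zpow_one, hρ, Equiv.Perm.mul_apply, hξx]
  have hne := Equiv.Perm.mul_zpow_mul_apply_ne hξ hη fξ fη
  rw [← hρ] at hne
  let s : Setoid α :=
    { r := fun y z => ∃ i : ℤ, y = (ρ ^ i) z ∨ y = ξ ((ρ ^ i) z)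
      iseqv :=
        { refl := fun x => ⟨0, by simp⟩
          symm := by
            rintro x y ⟨i, rfl | rfl⟩
            · exact ⟨-i, .inl (by simp)⟩
            · exact ⟨i, .inr (by rw [hc i (ξ _), hξx, hadd]; simp)⟩
          trans := by
            rintro x y z ⟨i, rfl | rfl⟩ ⟨j, rfl | rfl⟩
            · exact ⟨i + j, .inl (by rw [hadd])⟩
            · exact ⟨-i + j, .inr (by rw [← hadd, hc (-i), neg_neg])⟩
            · exact ⟨i + j, .inr (by rw [hadd])⟩
            · exact ⟨-i + j, .inl (by rw [hc i, hξx, hadd])⟩ } }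
  let R : α → α → Prop := fun y z => ∃ (q : Quotient s) (i : ℤ),
    (y = (ρ ^ i) q.out ∧ z = (ρ ^ (-i)) q.out) ∨
      (y = ξ ((ρ ^ i) q.out) ∧ z = η ((ρ ^ (-i)) q.out))
  have hex : ∀ y, ∃ z, R y z := fun y => by
    obtain ⟨i, h | h⟩ := s.symm (Quotient.mk_out (s := s) y)
    · exact ⟨_, _, i, .inl ⟨h, rfl⟩⟩
    · exact ⟨_, _, i, .inr ⟨h, rfl⟩⟩
  have hout : ∀ (q q' : Quotient s) (i : ℤ),
      (q.out = (ρ ^ i) q'.out ∨ q.out = ξ ((ρ ^ i) q'.out)) → q = q' := fun q q' i h => by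
    rw [← q.out_eq, ← q'.out_eq]
    exact Quotient.sound ⟨i, h⟩
  have hcancel : ∀ (q q' : Quotient s) (i j : ℤ), (ρ ^ i) q.out = (ρ ^ j) q'.out →
      q = q' ∧ (ρ ^ (-i)) q.out = (ρ ^ (-j)) q'.out := fun q q' i j h => by
    have h1 : q.out = (ρ ^ (-i + j)) q'.out := by rw [← hadd, ← h, hadd]; simp
    obtain rfl := hout _ _ _ (.inl h1)
    refine ⟨rfl, ?_⟩
    conv_rhs => rw [h1, hadd]
    simp
  have hmix : ∀ (q q' : Quotient s) (i j : ℤ), (ρ ^ i) q.out ≠ ξ ((ρ ^ j) q'.out) :=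
    fun q q' i j h => by
    have h1 : q.out = ξ ((ρ ^ (i + j)) q'.out) := by
      rw [← hadd, hc, ← h, hadd]; simp
    obtain rfl := hout _ _ _ (.inr h1)
    exact hne _ _ h1.symm
  have huniq : ∀ {y z z'}, R y z → R y z' → z = z' := by
    rintro y z z' ⟨q, i, ⟨rfl, rfl⟩ | ⟨rfl, rfl⟩⟩ ⟨q', j, ⟨h, rfl⟩ | ⟨h, rfl⟩⟩
    · exact (hcancel _ _ _ _ h).2
    · exact (hmix _ _ _ _ h).elim
    · exact (hmix _ _ _ _ h.symm).elim
    · rw [(hcancel _ _ _ _ (ξ.injective h)).2]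
  have hsymm : ∀ {y z}, R y z → R z y := by
    rintro y z ⟨q, i, ⟨rfl, rfl⟩ | ⟨rfl, rfl⟩⟩
    · exact ⟨q, -i, .inl ⟨rfl, by simp⟩⟩
    · exact ⟨q, -i + 1, .inr ⟨hηρ _ _, by rw [hηρ]; simp⟩⟩
  have hRξ : ∀ {y z}, R y z → R (ξ y) (η z) := by
    rintro y z ⟨q, i, ⟨rfl, rfl⟩ | ⟨rfl, rfl⟩⟩
    · exact ⟨q, i, .inr ⟨rfl, rfl⟩⟩
    · exact ⟨q, i, .inl ⟨hξx _, hηx _⟩⟩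
  choose f hf using hex
  have hff : Function.Involutive f := fun x => huniq (hf _) (hsymm (hf x))
  refine ⟨hff.toPerm, ?_, ?_⟩
  · ext x
    exact huniq (hf _) (hRξ (hf x))
  · ext x
    exact huniq (hf _) (hsymm (hRξ (hsymm (hf x))))

/-- The centralizer of a fixed-point-free involution satisfies Gelfand's criterion. -/
theorem Equiv.Perm.exists_inv_eq_mul_mul {α : Type*} {ξ : Equiv.Perm α} (hξ : ξ * ξ = 1)
    (fξ : ∀ x, ξ x ≠ x) (g : Equiv.Perm α) :
    ∃ h₁ ∈ Subgroup.centralizer {ξ}, ∃ h₂ ∈ Subgroup.centralizer {ξ}, g⁻¹ = h₁ * g * h₂ := by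
  obtain ⟨k, h1, h2⟩ := exists_conj_swap (ξ := ξ) (η := g * ξ * g⁻¹) hξ
    (by rw [conj_mul, hξ]; simp) fξ
    (fun x hx => fξ (g⁻¹ x) (by rw [Equiv.Perm.eq_inv_iff_eq]; exact hx))
  have hk : ∀ {a : Equiv.Perm α}, a ∈ Subgroup.centralizer {ξ} ↔ ξ * a = a * ξ := by
    simp [Subgroup.mem_centralizer_singleton_iff, eq_comm]
  refine ⟨g⁻¹ * k, hk.2 ?_, (k * g)⁻¹, inv_mem (hk.2 ?_), by group⟩
  · rw [mul_assoc g⁻¹, h1]; group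
  · rw [← mul_assoc, ← h2]; group

/-- Gelfand's trick: if every `g⁻¹` lies in the double coset `HgH`, then the `H`-invariants of an
irreducible representation are at most one-dimensional. -/
theorem Representation.finrank_invariants_le_one {k G V : Type*} [Field k] [IsAlgClosed k]
    [Group G] [AddCommGroup V] [Module k V] [FiniteDimensional k V] (ρ : Representation k G V)
    [ρ.IsIrreducible] (H : Subgroup G) [Fintype H] [Invertible (Fintype.card H : k)]
    (hH : ∀ g : G, ∃ h₁ ∈ H, ∃ h₂ ∈ H, g⁻¹ = h₁ * g * h₂) :
    Module.finrank k (invariants (ρ.comp H.subtype)) ≤ 1 := by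
  set W := invariants (ρ.comp H.subtype) with hW
  set e : Module.End k V := averageMap (ρ.comp H.subtype) with he
  have he_sum : e = ⅟(Fintype.card H : k) • ∑ h : H, ρ h := by
    simp [he, GroupAlgebra.average, map_sum]
  have heW : ∀ v, e v ∈ W := averageMap_invariant _
  have heid : ∀ v ∈ W, e v = v := averageMap_id _
  have hleft : ∀ h ∈ H, ρ h * e = e := fun h hh => by
    ext v
    exact heW v ⟨h, hh⟩
  have hright : ∀ h ∈ H, e * ρ h = e := fun h hh => by
    rw [he_sum, smul_mul_assoc, Finset.sum_mul]
    congr 1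
    exact Fintype.sum_equiv (Equiv.mulRight (⟨h, hh⟩ : H)) _ _ fun x => by simp
  let T : G → Module.End k V := fun g => e * ρ g * e
  have hTW : ∀ g v, T g v ∈ W := fun g v => heW _
  have hTinv : ∀ g, T g⁻¹ = T g := fun g => by
    obtain ⟨h₁, m₁, h₂, m₂, h⟩ := hH g
    simp only [T]
    rw [h, map_mul, map_mul, mul_assoc, mul_assoc _ (ρ h₂), hleft _ m₂, ← mul_assoc, ← mul_assoc,
      hright _ m₁]
  have hTT : ∀ a b, T a * T b = ⅟(Fintype.card H : k) • ∑ h : H, T (a * h * b) := fun a b => by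
    have hee : e * e = e := by ext v; exact heid _ (heW v)
    calc T a * T b = e * ρ a * (e * e) * ρ b * e := by simp only [T, mul_assoc]
      _ = _ := by
        rw [hee]
        nth_rw 2 [he_sum]
        simp only [T, map_mul, Finset.mul_sum, Finset.sum_mul, mul_smul_comm, smul_mul_assoc,
          mul_assoc]
  have hcomm : ∀ a b, T a * T b = T b * T a := fun a b => by
    rw [hTT, ← hTinv b, ← hTinv a, hTT]
    congr 1
    refine Fintype.sum_equiv (Equiv.inv H) _ _ fun h => ?_
    rw [← hTinv]
    simp [mul_assoc]
  have hcyc : ∀ v ∈ W, v ≠ 0 → ∀ U : Submodule k V, (∀ g, T g v ∈ U) → W ≤ U := by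
    intro v hv hv0 U hU w hw
    let S : Subrepresentation ρ :=
      { toSubmodule := Submodule.span k (Set.range fun g => ρ g v)
        apply_mem_toSubmodule := fun g x hx => by
          induction hx using Submodule.span_induction with
          | mem x hx =>
            obtain ⟨a, rfl⟩ := hx
            exact Submodule.subset_span ⟨g * a, by simp⟩
          | zero => simp
          | add x y _ _ hx hy => rw [map_add]; exact add_mem hx hy
          | smul c x _ hx => rw [map_smul]; exact Submodule.smul_mem _ _ hx }
    have hvS : v ∈ S := Submodule.subset_span ⟨1, by simp⟩
    have hS : S = ⊤ := (eq_bot_or_eq_top S).resolve_left fun h => hv0 (by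
      rw [h] at hvS; exact hvS)
    have hwS : w ∈ S := by rw [hS]; trivial
    have hle : Submodule.span k (Set.range fun g => ρ g v) ≤ U.comap e := by
      rw [Submodule.span_le]
      rintro _ ⟨g, rfl⟩
      have := hU g
      simpa [T, heid v hv] using this
    rw [← heid w hw]
    exact hle hwS
  rcases subsingleton_or_nontrivial W with hs | hn
  · rw [Module.finrank_zero_of_subsingleton]; exact zero_le_one
  have hscalar : ∀ g, ∃ μ : k, ∀ w ∈ W, T g w = μ • w := fun g => by
    obtain ⟨μ, hμ⟩ := Module.End.exists_eigenvalue
      ((T g).restrict (p := W) (q := W) fun v _ => hTW g v)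
    obtain ⟨v, hv⟩ := hμ.exists_hasEigenvector
    have hv1 : T g v = μ • (v : V) := congrArg Subtype.val hv.apply_eq_smul
    refine ⟨μ, fun w hw => ?_⟩
    have := hcyc v v.2 (by simpa using hv.2) (LinearMap.ker (T g - μ • 1)) (fun a => by
      have : T g (T a v) = T a (T g v) := congrArg (fun f : Module.End k V => f v) (hcomm g a)
      simp [this, hv1]) hw
    simpa [sub_eq_zero] using this
  obtain ⟨v, hv⟩ := exists_ne (0 : W)
  have hle : W ≤ Submodule.span k {(v : V)} := hcyc v v.2 (by simpa using hv) _ fun g => by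
    obtain ⟨μ, hμ⟩ := hscalar g
    rw [hμ v v.2]
    exact Submodule.smul_mem _ _ (Submodule.mem_span_singleton_self _)
  exact (Submodule.finrank_mono hle).trans (finrank_span_singleton (by simpa using hv)).le

/-- The irreducible complex characters of a group. -/
def IsIrredChar {G : Type} [Group G] (χ : G → ℂ) : Prop :=
  ∃ V : FDRep ℂ G, CategoryTheory.Simple V ∧ χ = V.character

namespace Representation

variable {G : Type} [Group G] {V : Type} [AddCommGroup V] [Module ℂ V] [FiniteDimensional ℂ V]

theorem IsIrreducible.isIrredChar [Finite G] (ρ : Representation ℂ G V) [ρ.IsIrreducible] :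
    IsIrredChar ρ.character := by
  have := Fintype.ofFinite G
  have := invertibleOfNonzero (NeZero.ne (Nat.card G : ℂ))
  refine ⟨FDRep.of ρ, (FDRep.simple_iff_char_is_norm_one _).2 ?_, rfl⟩
  have h := char_orthonormal ρ ρ
  rw [if_pos ⟨Equiv.refl ρ⟩, inv_mul_eq_one₀ (NeZero.ne _)] at h
  exact h.symm

theorem character_eq_add_of_isCompl {ρ : Representation ℂ G V} {p q : Subrepresentation ρ}
    (h : IsCompl p q) :
    ρ.character = p.toRepresentation.character + q.toRepresentation.character := by
  have h' : IsCompl p.toSubmodule q.toSubmodule :=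
    ⟨disjoint_iff.2 (congrArg Subrepresentation.toSubmodule h.inf_eq_bot),
      codisjoint_iff.2 (congrArg Subrepresentation.toSubmodule h.sup_eq_top)⟩
  ext g
  let N : Bool → Submodule ℂ V := fun b => bif b then p.toSubmodule else q.toSubmodule
  have hN : DirectSum.IsInternal N :=
    (DirectSum.isInternal_submodule_iff_isCompl N (i := true) (j := false) (by simp)
      (by ext b; cases b <;> simp)).2 h'
  have hm : ∀ b, Set.MapsTo (ρ g) (N b) (N b) := fun b => by
    cases b
    · exact q.apply_mem_toSubmodule g
    · exact p.apply_mem_toSubmodule g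
  have := LinearMap.trace_eq_sum_trace_restrict hN hm
  rw [Fintype.sum_bool] at this
  exact this

/-- Every character of a finite group is a sum of irreducible characters. -/
theorem exists_character_eq_sum [Finite G] (ρ : Representation ℂ G V) :
    ∃ m : Multiset (G → ℂ), (∀ χ ∈ m, IsIrredChar χ) ∧ ρ.character = m.sum := by
  induction h : Module.finrank ℂ V using Nat.strong_induction_on generalizing V with
  | _ n ih =>
    subst h
    rcases subsingleton_or_nontrivial V with hV | hV
    · exact ⟨0, by simp, by ext g; simp [character, Subsingleton.elim (ρ g) 0]⟩
    have hbt : (⊥ : Subrepresentation ρ) ≠ ⊤ := fun h =>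
      bot_ne_top (α := Submodule ℂ V) (congrArg Subrepresentation.toSubmodule h)
    have : Nontrivial (Subrepresentation ρ) := ⟨_, _, hbt⟩
    by_cases hs : ρ.IsIrreducible
    · exact ⟨{ρ.character}, by simpa using IsIrreducible.isIrredChar ρ, by simp⟩
    obtain ⟨p, hp⟩ : ∃ p : Subrepresentation ρ, p ≠ ⊥ ∧ p ≠ ⊤ := by
      by_contra! hc
      exact hs ⟨fun p => or_iff_not_imp_left.2 (hc p)⟩
    obtain ⟨q, hq⟩ := exists_isCompl p
    have hlt : ∀ r : Subrepresentation ρ, r ≠ ⊤ →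
        Module.finrank ℂ r.toSubmodule < Module.finrank ℂ V := fun r hr =>
      Submodule.finrank_lt fun h => hr (Subrepresentation.toSubmodule_injective h)
    obtain ⟨m₁, h₁, e₁⟩ := ih _ (hlt p hp.2) p.toRepresentation rfl
    obtain ⟨m₂, h₂, e₂⟩ := ih _ (hlt q fun h => hp.1 (by
      rw [h] at hq; exact eq_bot_of_isCompl_top hq)) q.toRepresentation rfl
    refine ⟨m₁ + m₂, fun χ hχ => ?_, ?_⟩
    · exact (Multiset.mem_add.1 hχ).elim (h₁ χ) (h₂ χ)
    · rw [character_eq_add_of_isCompl hq, e₁, e₂, Multiset.sum_add]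

end Representation

open CategoryTheory in
theorem FDRep.isIrreducible_of_simple {G : Type} [Group G] (V : FDRep ℂ G) [Simple V] :
    Representation.IsIrreducible (V.ρ : Representation ℂ G V) where
  exists_pair_ne := ⟨⊥, ⊤, fun h => by
    have h' : (⊥ : Submodule ℂ V) = ⊤ := congrArg Subrepresentation.toSubmodule h
    apply id_nonzero V
    ext x
    exact (Submodule.mem_bot ℂ).1 (h' ▸ Submodule.mem_top : (x : V) ∈ (⊥ : Submodule ℂ V))⟩
  eq_bot_or_eq_top p := by
    let f : FDRep.of p.toRepresentation ⟶ V :=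
      FDRep.forget₂HomLinearEquiv _ _ (Rep.ofHom ⟨p.toSubmodule.subtype, fun g => rfl⟩)
    have hfv : ∀ x : p.toSubmodule, f x = (x : V) := fun x => rfl
    have hmono : Mono f := ConcreteCategory.mono_of_injective f Subtype.val_injective
    by_cases hf : f = 0
    · left
      apply Subrepresentation.toSubmodule_injective
      refine (Submodule.eq_bot_iff _).2 fun x hx => ?_
      have h := hfv ⟨x, hx⟩
      rw [hf] at h
      exact h.symm
    · right
      have := isIso_of_mono_of_nonzero hf
      apply Subrepresentation.toSubmodule_injective
      refine Submodule.eq_top_iff'.2 fun x => ?_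
      obtain ⟨y, rfl⟩ := (ConcreteCategory.bijective_of_isIso f).2 x
      exact y.2

/-- First orthogonality relation. -/
theorem IsIrredChar.inner_eq {G : Type} [Group G] [Fintype G] [DecidableEq (G → ℂ)]
    {χ ψ : G → ℂ} (hχ : IsIrredChar χ) (hψ : IsIrredChar ψ) :
    (Nat.card G : ℂ)⁻¹ * ∑ g, χ g * ψ g⁻¹ = if χ = ψ then 1 else 0 := by
  have := invertibleOfNonzero (NeZero.ne (Nat.card G : ℂ))
  obtain ⟨V, hV, rfl⟩ := hχ
  obtain ⟨W, hW, rfl⟩ := hψ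
  rw [FDRep.char_orthonormal]
  by_cases h : Nonempty (V ≅ W)
  · rw [if_pos h, if_pos (FDRep.char_iso h.some)]
  · rw [if_neg h, if_neg]
    intro he
    have h1 := FDRep.char_orthonormal V W
    have h2 := FDRep.char_orthonormal W W
    rw [if_neg h, he] at h1
    rw [if_pos ⟨CategoryTheory.Iso.refl W⟩, h1] at h2
    exact zero_ne_one h2

theorem IsIrredChar.inner_sum_eq_count {G : Type} [Group G] [Fintype G] [DecidableEq (G → ℂ)]
    {m : Multiset (G → ℂ)} (hm : ∀ χ ∈ m, IsIrredChar χ) {ψ : G → ℂ} (hψ : IsIrredChar ψ) :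
    (Nat.card G : ℂ)⁻¹ * ∑ g, m.sum g * ψ g⁻¹ = m.count ψ := by
  induction m using Multiset.induction with
  | empty => simp
  | cons χ m ih =>
    rw [Multiset.forall_mem_cons] at hm
    simp only [Multiset.sum_cons, Pi.add_apply, add_mul, Finset.sum_add_distrib, mul_add,
      hm.1.inner_eq hψ, ih hm.2, Multiset.count_cons, eq_comm (a := ψ)]
    split_ifs <;> simp [add_comm]

theorem Representation.character_ofMulAction {G X : Type*} [Group G] [MulAction G X] [Fintype X]
    [DecidableEq X] (g : G) :
    (ofMulAction ℂ G X).character g = Finset.card {x : X | g • x = x} := by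
  let b : Module.Basis X ℂ (MonoidAlgebra ℂ X) := ⟨MonoidAlgebra.coeffLinearEquiv ℂ⟩
  have hb : ∀ x, b x = MonoidAlgebra.single x 1 := fun x => by
    rfl
  rw [character, LinearMap.trace_eq_matrix_trace ℂ b, Matrix.trace, Finset.card_filter]
  push_cast
  refine Finset.sum_congr rfl fun x _ => ?_
  rw [Matrix.diag_apply, LinearMap.toMatrix_apply, hb, ofMulAction_single, ← hb, b.repr_self,
    Finsupp.single_apply]

open Classical in
/-- Frobenius reciprocity for the permutation character of `G ⧸ H`. -/
theorem Subgroup.inner_fixed_quotient_eq {G : Type*} [Group G] [Fintype G] (H : Subgroup G)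
    [Fintype H] {f : G → ℂ} (hf : ∀ g h, f (h * g * h⁻¹) = f g) :
    (Nat.card G : ℂ)⁻¹ * ∑ g : G, (Finset.card {x : G ⧸ H | g • x = x} : ℂ) * f g⁻¹ =
      (Nat.card H : ℂ)⁻¹ * ∑ h : H, f h := by
  have key : ∀ x : G ⧸ H, ∑ g : G, (if g • x = x then f g⁻¹ else 0) = ∑ h : H, f h := by
    intro x
    induction x using QuotientGroup.induction_on with | _ t
    rw [← Finset.sum_filter]
    have hmem : ∀ g : G, g • (t : G ⧸ H) = t ↔ t⁻¹ * g⁻¹ * t ∈ H := fun g => by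
      change ((g * t : G) : G ⧸ H) = t ↔ _
      rw [QuotientGroup.eq, mul_inv_rev]
    refine Finset.sum_bij' (i := fun g hg => ⟨t⁻¹ * g⁻¹ * t, ?_⟩) (j := fun h _ => t * h⁻¹ * t⁻¹)
      ?_ ?_ ?_ ?_ ?_
    · exact (hmem g).1 (Finset.mem_filter.1 hg).2
    · simp
    · intro h _
      rw [Finset.mem_filter, hmem]
      simp [mul_assoc]
    · intro g _
      simp [mul_assoc]
    · intro h _
      simp [mul_assoc]
    · intro g _
      simpa [mul_assoc] using (hf g⁻¹ t⁻¹).symm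
  have hcard : (Nat.card G : ℂ) = Nat.card (G ⧸ H) * Nat.card H := by
    rw [H.card_eq_card_quotient_mul_card_subgroup]; push_cast; rfl
  simp_rw [Finset.card_filter, Nat.cast_sum, Finset.sum_mul]
  rw [Finset.sum_comm]
  simp only [Nat.cast_ite, Nat.cast_one, Nat.cast_zero, ite_mul, one_mul, zero_mul, key]
  rw [Finset.sum_const, Finset.card_univ, nsmul_eq_mul, hcard, ← Nat.card_eq_fintype_card]
  have h1 : (Nat.card (G ⧸ H) : ℂ) ≠ 0 := NeZero.ne _
  field_simp

open Classical in
/-- The permutation character of `G ⧸ H`, for `H` satisfying Gelfand's criterion, is the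
multiplicity-free sum of the irreducible characters that do not sum to zero on `H`. -/
theorem Subgroup.exists_card_fixed_quotient_eq_sum {G : Type} [Group G] [Fintype G]
    (H : Subgroup G) (hH : ∀ g : G, ∃ h₁ ∈ H, ∃ h₂ ∈ H, g⁻¹ = h₁ * g * h₂) :
    ∃ s : Finset (G → ℂ), (∀ χ, χ ∈ s ↔ IsIrredChar χ ∧ ∑ h : H, χ h ≠ 0) ∧
      ∀ g : G, (Finset.card {x : G ⧸ H | g • x = x} : ℂ) = ∑ χ ∈ s, χ g := by
  have := invertibleOfNonzero (NeZero.ne (Fintype.card H : ℂ))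
  have := invertibleOfNonzero (NeZero.ne (Nat.card H : ℂ))
  have : FiniteDimensional ℂ (MonoidAlgebra ℂ (G ⧸ H)) :=
    Module.Finite.equiv (MonoidAlgebra.coeffLinearEquiv ℂ).symm
  obtain ⟨m, hm, hsum⟩ := (Representation.ofMulAction ℂ G (G ⧸ H)).exists_character_eq_sum
  have hfix : ∀ g : G, (Finset.card {x : G ⧸ H | g • x = x} : ℂ) = m.sum g := fun g => by
    rw [← hsum, Representation.character_ofMulAction]
  have hcount : ∀ χ, IsIrredChar χ → (m.count χ : ℂ) = (Nat.card H : ℂ)⁻¹ * ∑ h : H, χ h := by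
    intro χ hχ
    rw [← IsIrredChar.inner_sum_eq_count hm hχ, ← H.inner_fixed_quotient_eq (f := χ)]
    · simp_rw [hfix]
    · obtain ⟨V, -, rfl⟩ := hχ
      exact V.char_conj
  have hle : ∀ χ, IsIrredChar χ → m.count χ ≤ 1 := by
    intro χ hχ
    have hc := hcount χ hχ
    obtain ⟨V, hV, rfl⟩ := hχ
    have := V.isIrreducible_of_simple
    have h := Representation.card_inv_mul_sum_char_eq_finrank (V.ρ.comp H.subtype)
    have : m.count V.character =
        Module.finrank ℂ (Representation.invariants (V.ρ.comp H.subtype)) := by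
      exact_mod_cast hc.trans h
    rw [this]
    exact Representation.finrank_invariants_le_one V.ρ H hH
  have hnodup : m.Nodup := Multiset.nodup_iff_count_le_one.2 fun χ => by
    by_cases h : χ ∈ m
    · exact hle χ (hm χ h)
    · rw [Multiset.count_eq_zero.2 h]; exact zero_le_one
  refine ⟨m.toFinset, fun χ => ?_, fun g => ?_⟩
  · rw [Multiset.mem_toFinset]
    have hiff : IsIrredChar χ → (χ ∈ m ↔ ∑ h : H, χ h ≠ 0) := fun hχ => by
      rw [← Multiset.count_ne_zero, ← Nat.cast_ne_zero (R := ℂ), hcount χ hχ]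
      simp [mul_eq_zero]
    exact ⟨fun h => ⟨hm χ h, (hiff (hm χ h)).1 h⟩, fun h => (hiff h.1).2 h.2⟩
  · rw [hfix, Finset.sum_multiset_count, Finset.sum_apply]
    refine Finset.sum_congr rfl fun χ hχ => ?_
    rw [Multiset.count_eq_one_of_mem hnodup (Multiset.mem_toFinset.1 hχ), one_smul]

open Classical in
/-- Burnside's lemma for the diagonal action on tuples. -/
theorem MulAction.sum_card_fixed_pow_eq {G X ι : Type*} [Group G] [Fintype G] [MulAction G X]
    [Fintype X] [Fintype ι] :
    ∑ g : G, Finset.card {x : X | g • x = x} ^ Fintype.card ι =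
      Nat.card (Quotient (MulAction.orbitRel G (ι → X))) * Fintype.card G := by
  rw [Nat.card_eq_fintype_card,
    ← MulAction.sum_card_fixedBy_eq_card_orbits_mul_card_group G (ι → X)]
  refine Finset.sum_congr rfl fun g _ => ?_
  rw [← Finset.card_univ, ← Finset.prod_const, ← Fintype.card_piFinset]
  rw [← Fintype.card_coe]
  refine Fintype.card_congr (Equiv.subtypeEquivRight fun x => ?_)
  simp [Fintype.mem_piFinset, MulAction.mem_fixedBy, funext_iff]

/-- Classes of tuples correspond to diagonal orbits on tuples of cosets via `σ ↦ (σᵢ⁻¹H)ᵢ`. -/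
theorem Znum_eq_card_orbits (n d : ℕ) (ξ : PermG n) :
    Znum n d ξ =
      Nat.card (Quotient (MulAction.orbitRel (PermG n) (Fin d → PermG n ⧸ wreathH n ξ))) := by
  let F : (Fin d → PermG n) → (Fin d → PermG n ⧸ wreathH n ξ) := fun σ i => ((σ i)⁻¹ : PermG n)
  have hF : ∀ σ σ', tensorRel n d ξ σ σ' ↔ MulAction.orbitRel (PermG n) _ (F σ) (F σ') := by
    intro σ σ'
    rw [MulAction.orbitRel_apply, MulAction.mem_orbit_iff]
    have hγ : ∀ γ : PermG n, γ • F σ' = F σ ↔ ∀ i, σ' i * γ⁻¹ * (σ i)⁻¹ ∈ wreathH n ξ := by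
      intro γ
      rw [funext_iff]
      refine forall_congr' fun i => ?_
      change ((γ * (σ' i)⁻¹ : PermG n) : PermG n ⧸ wreathH n ξ) = ((σ i)⁻¹ : PermG n) ↔ _
      rw [QuotientGroup.eq, mul_inv_rev, inv_inv]
    simp_rw [hγ]
    constructor
    · rintro ⟨γv, γ, h⟩
      refine ⟨γ, fun i => ?_⟩
      rw [h i]
      simp
    · rintro ⟨γ, h⟩
      exact ⟨fun i => ⟨_, h i⟩, γ, fun i => by simp⟩
  refine Nat.card_congr (Equiv.ofBijective
    (Quot.lift (fun σ => Quotient.mk _ (F σ)) fun σ σ' h => Quotient.sound ((hF σ σ').1 h))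
    ⟨?_, ?_⟩)
  · rintro ⟨σ⟩ ⟨σ'⟩ h
    exact Quot.sound ((hF σ σ').2 (Quotient.exact h))
  · rintro ⟨x⟩
    refine ⟨Quot.mk _ fun i => (x i).out⁻¹, congrArg (Quotient.mk _) ?_⟩
    funext i
    simp [F]

/-- For every `d ≥ 1`, `Z_d(2n)` equals the sum, over all `d`-tuples `(χ₁,…,χ_d)` of
irreducible complex characters of `G = S_{2n}` satisfying `Σ_{h ∈ H} χᵢ(h) ≠ 0` for each
`i`, of `C_d(χ₁,…,χ_d) = (1/(2n)!) · Σ_{γ ∈ G} χ₁(γ)·χ₂(γ)⋯χ_d(γ)`. -/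
theorem stmt6 (n d : ℕ) (hn : 1 ≤ n) (hd : 1 ≤ d) (ξ : PermG n)
    (hinv : ξ * ξ = 1) (hfpf : ∀ x, ξ x ≠ x) :
    (Znum n d ξ : ℂ) =
      ∑ᶠ χ ∈ {χ : Fin d → (PermG n → ℂ) | ∀ i, χ i ∈ goodChars n ξ},
        (1 / ((2 * n).factorial : ℂ)) * ∑ γ : PermG n, ∏ i, χ i γ := by
  classical
  obtain ⟨s, hs, hfix⟩ := (wreathH n ξ).exists_card_fixed_quotient_eq_sum
    (Equiv.Perm.exists_inv_eq_mul_mul hinv hfpf)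
  have hgood : ∀ χ, χ ∈ goodChars n ξ ↔ χ ∈ s := fun χ => by
    rw [hs, ← finsum_eq_sum_of_fintype]
    rfl
  have hset : {χ : Fin d → (PermG n → ℂ) | ∀ i, χ i ∈ goodChars n ξ} =
      (Fintype.piFinset fun _ : Fin d => s : Finset _) := by
    ext χ
    simp [hgood]
  have hburnside := congrArg (Nat.cast (R := ℂ))
    (MulAction.sum_card_fixed_pow_eq (G := PermG n) (X := PermG n ⧸ wreathH n ξ) (ι := Fin d))
  rw [← Znum_eq_card_orbits, Fintype.card_perm, Fintype.card_fin, Fintype.card_fin] at hburnside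
  push_cast at hburnside
  rw [hset, finsum_mem_coe_finset, ← Finset.mul_sum, Finset.sum_comm, one_div,
    eq_inv_mul_iff_mul_eq₀ (Nat.cast_ne_zero.2 (Nat.factorial_ne_zero _)), mul_comm, ← hburnside]
  refine Finset.sum_congr rfl fun γ _ => ?_
  trans (∑ χ ∈ s, χ γ) ^ d
  · rw [← hfix]
    congr!
  · simpa using Finset.prod_univ_sum (fun _ : Fin d => s) fun _ χ => χ γ
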